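/- arXiv:2007.09553 — 5 statements merged into one kernel-verified Lean document; each statement's English description precedes it below -/
import Mathlib

section
/- Let p be an odd prime, n ≥ 2, q = p^n, and 1 ≤ k < n. For all α, β ∈ 𝔽_q, S_{α,β} = χ₁(β)·Σ_{x ∈ 𝔽_q} χ₁((α+β)·x^{p^k+1} + (β^{p^{n−k}}+β)·x). -/
open scoped BigOperators Classical

/-- The canonical additive character `χ₁` of a finite field `K` of characteristic `p`:
`χ₁(a) = exp(2πi·Tr(a)/p)` where `Tr` is the absolute trace to `ZMod p`. -/
noncomputable def chi1 (p : ℕ) (K : Type*) [Field K] [Algebra (ZMod p) K] (a : K) : ℂ :=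
  Complex.exp (2 * Real.pi * Complex.I * ((Algebra.trace (ZMod p) K a).val : ℂ) / (p : ℂ))

/-- The Weil sum `S_{α,β} = Σ_{x ∈ K} χ₁(α·x^d + β·(x+1)^d)`. -/
noncomputable def weilS (p : ℕ) (K : Type*) [Field K] [Fintype K] [Algebra (ZMod p) K]
    (d : ℕ) (α β : K) : ℂ :=
  ∑ x : K, chi1 p K (α * x ^ d + β * (x + 1) ^ d)

lemma chi1_eq_stdAddChar (p : ℕ) [Fact p.Prime] (K : Type*) [Field K] [Algebra (ZMod p) K]
    (a : K) : chi1 p K a = ZMod.stdAddChar (Algebra.trace (ZMod p) K a) := by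
  rw [ZMod.stdAddChar_apply, ZMod.toCircle_apply, chi1]

lemma chi1_add (p : ℕ) [Fact p.Prime] (K : Type*) [Field K] [Algebra (ZMod p) K]
    (a b : K) : chi1 p K (a + b) = chi1 p K a * chi1 p K b := by
  simp only [chi1_eq_stdAddChar, map_add, AddChar.map_add_eq_mul]

lemma FiniteField.trace_pow_prime_pow (p : ℕ) [Fact p.Prime] (K : Type*) [Field K] [Finite K]
    [Algebra (ZMod p) K] (k : ℕ) (a : K) :
    Algebra.trace (ZMod p) K (a ^ p ^ k) = Algebra.trace (ZMod p) K a := by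
  induction k with
  | zero => simp
  | succ k ih =>
    have h := Algebra.trace_eq_of_algEquiv
      (FiniteField.frobeniusAlgEquivOfAlgebraic (ZMod p) K) (a ^ p ^ k)
    rw [FiniteField.coe_frobeniusAlgEquivOfAlgebraic, ZMod.card] at h
    rw [pow_succ, pow_mul]
    exact h.trans ih

/-- The adjoint of `x ↦ x ^ p ^ k` for the trace form is `β ↦ β ^ p ^ (n - k)`. -/
lemma chi1_mul_pow_prime_pow (p n k : ℕ) [Fact p.Prime] (hkn : k ≤ n)
    (K : Type*) [Field K] [Fintype K] [Algebra (ZMod p) K] (hcard : Fintype.card K = p ^ n)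
    (β x : K) : chi1 p K (β * x ^ p ^ k) = chi1 p K (β ^ p ^ (n - k) * x) := by
  have h : (β ^ p ^ (n - k) * x) ^ p ^ k = β * x ^ p ^ k := by
    rw [mul_pow, ← pow_mul, ← pow_add, Nat.sub_add_cancel hkn, ← hcard, FiniteField.pow_card]
  rw [chi1_eq_stdAddChar, chi1_eq_stdAddChar, ← h, FiniteField.trace_pow_prime_pow]

theorem weilS_gold_reduction (p n k : ℕ) [Fact p.Prime] (hp : Odd p) (hn : 2 ≤ n)
    (hk1 : 1 ≤ k) (hkn : k < n)
    (K : Type*) [Field K] [Fintype K] [Algebra (ZMod p) K]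
    (hcard : Fintype.card K = p ^ n)
    (α β : K) :
    weilS p K (p ^ k + 1) α β =
      chi1 p K β *
        ∑ x : K, chi1 p K ((α + β) * x ^ (p ^ k + 1) + (β ^ (p ^ (n - k)) + β) * x) := by
  have : CharP K p := charP_of_injective_algebraMap (algebraMap (ZMod p) K).injective p
  rw [weilS, Finset.mul_sum]
  refine Finset.sum_congr rfl fun x _ => ?_
  have h : α * x ^ (p ^ k + 1) + β * (x + 1) ^ (p ^ k + 1) =
      β + ((α + β) * x ^ (p ^ k + 1) + (β * x ^ p ^ k + β * x)) := by
    rw [pow_succ (x + 1), add_pow_char_pow, one_pow]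
    ring
  rw [h, add_mul (β ^ p ^ (n - k))]
  simp only [chi1_add, chi1_mul_pow_prime_pow p n k hkn.le K hcard]
end

section
/- Let p be an odd prime, n ≥ 2, q = p^n, and 1 ≤ k < n. If β ∈ 𝔽_q \ {0} satisfies β^{p^{n−k}} = −β and α = −β, then S_{α,β} = q·χ₁(β). -/
open scoped BigOperators Classical

/-- The absolute trace is invariant under powers of the Frobenius. -/
theorem trace_pow_card_pow (p : ℕ) [Fact p.Prime] (K : Type*) [Field K] [Finite K]
    [Algebra (ZMod p) K] (m : ℕ) (a : K) :
    Algebra.trace (ZMod p) K (a ^ p ^ m) = Algebra.trace (ZMod p) K a := by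
  induction m with
  | zero => simp
  | succ m ih =>
    rw [pow_succ, pow_mul, ← ih]
    have h := Algebra.trace_eq_of_algEquiv
      (FiniteField.frobeniusAlgEquivOfAlgebraic (ZMod p) K) (a ^ p ^ m)
    simpa [ZMod.card] using h

theorem weilS_gold_degenerate_eq (p n k : ℕ) [Fact p.Prime] (hp : Odd p) (hn : 2 ≤ n)
    (hk1 : 1 ≤ k) (hkn : k < n)
    (K : Type*) [Field K] [Fintype K] [Algebra (ZMod p) K]
    (hcard : Fintype.card K = p ^ n)
    (α β : K) (hβ0 : β ≠ 0) (hβ : β ^ (p ^ (n - k)) = -β) (hα : α = -β) :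
    weilS p K (p ^ k + 1) α β = (p : ℂ) ^ n * chi1 p K β := by
  have : CharP K p := charP_of_injective_algebraMap (algebraMap (ZMod p) K).injective p
  have trace_mul_pow (x : K) : Algebra.trace (ZMod p) K (β * x ^ p ^ k) =
      -Algebra.trace (ZMod p) K (β * x) := by
    rw [← trace_pow_card_pow p K (n - k), mul_pow, hβ, ← pow_mul, ← pow_add,
      Nat.add_sub_cancel' hkn.le, ← hcard, FiniteField.pow_card, neg_mul, map_neg]
  have chi1_eq (x : K) : chi1 p K (α * x ^ (p ^ k + 1) + β * (x + 1) ^ (p ^ k + 1)) =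
      chi1 p K β := by
    have expand : α * x ^ (p ^ k + 1) + β * (x + 1) ^ (p ^ k + 1) =
        β * x ^ p ^ k + β * x + β := by
      rw [hα, pow_succ (x + 1), add_pow_char_pow, one_pow]
      ring
    rw [chi1, chi1, expand, map_add, map_add, trace_mul_pow, neg_add_cancel, zero_add]
  simp [weilS, chi1_eq, hcard]
end

section
/- Let p be an odd prime, n ≥ 2, q = p^n, 1 ≤ k < n, and e = gcd(n,k). The equation β^{p^k−1} = −1 has a solution β ∈ 𝔽_q if and only if n/e is even, and when n/e is even it has exactly p^e − 1 solutions in 𝔽_q (equivalently, there are exactly p^e − 1 nonzero β with β^{p^{n−k}} + β = 0). -/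
open scoped BigOperators Classical

theorem pow_pow_mul_eq_neg_one_pow_mul {R : Type*} [CommRing R] {p : ℕ} (hp : Odd p) {k : ℕ} {β : R}
    (h : β ^ p ^ k = -β) (j : ℕ) : β ^ p ^ (k * j) = (-1) ^ j * β := by
  induction j with
  | zero => simp
  | succ j ih =>
    rw [Nat.mul_succ, pow_add, pow_mul, ih, mul_pow, h, ← pow_mul, mul_comm j, pow_mul,
      (hp.pow (n := k)).neg_one_pow, pow_succ]
    ring

theorem pow_sub_one_eq_neg_one_iff {K : Type*} [Field K] {m : ℕ} (hm : 1 < m) {β : K} :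
    β ^ (m - 1) = -1 ↔ β ≠ 0 ∧ β ^ m = -β := by
  have hsucc : β ^ m = β ^ (m - 1) * β := by rw [← pow_succ, Nat.sub_add_cancel hm.le]
  constructor
  · intro h
    refine ⟨?_, by rw [hsucc, h, neg_one_mul]⟩
    rintro rfl
    rw [zero_pow (by omega)] at h
    simp at h
  · rintro ⟨h0, h⟩
    exact mul_right_cancel₀ h0 (by rw [← hsucc, h, neg_one_mul])

theorem card_pow_eq_of_exists {G : Type*} [CommGroup G] [IsCyclic G] [Finite G] {d : ℕ} {a : G}
    (h : ∃ b : G, b ^ d = a) : Nat.card {b : G // b ^ d = a} = (Nat.card G).gcd d := by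
  obtain ⟨b, rfl⟩ := h
  rw [← IsCyclic.card_powMonoidHom_ker]
  refine Nat.card_congr ((Equiv.mulLeft b⁻¹).subtypeEquiv fun c ↦ ?_)
  simp [MonoidHom.mem_ker, mul_pow, inv_mul_eq_one, eq_comm]

theorem card_pow_eq_neg_one_of_exists {K : Type*} [Field K] [Fintype K] {d : ℕ} (hd : d ≠ 0)
    (h : ∃ β : K, β ^ d = -1) :
    Nat.card {β : K // β ^ d = -1} = (Fintype.card K - 1).gcd d := by
  have hne {β : K} (hβ : β ^ d = -1) : β ≠ 0 := by
    rintro rfl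
    rw [zero_pow hd] at hβ
    simp at hβ
  have hunits : Nat.card {b : Kˣ // b ^ d = -1} = Nat.card {β : K // β ^ d = -1} := by
    refine Nat.card_congr ⟨fun b ↦ ⟨b.1, by rw [← Units.val_pow_eq_pow_val, b.2]; simp⟩,
      fun β ↦ ⟨Units.mk0 β.1 (hne β.2), Units.ext (by simpa using β.2)⟩, fun b ↦ ?_, fun β ↦ ?_⟩
    · ext; simp
    · ext; simp
  obtain ⟨β, hβ⟩ := h
  rw [← hunits, card_pow_eq_of_exists ⟨Units.mk0 β (hne hβ), Units.ext (by simpa using hβ)⟩,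
    Nat.card_eq_fintype_card, Fintype.card_units]

theorem exists_pow_eq_neg_one_of_two_mul_dvd {K : Type*} [Field K] [Fintype K] {d : ℕ}
    (h : 2 * d ∣ Fintype.card K - 1) : ∃ β : K, β ^ d = -1 := by
  obtain ⟨m, hm⟩ := h
  obtain ⟨ζ, hζ⟩ := IsCyclic.exists_ofOrder_eq_natCard (α := Kˣ)
  rw [Nat.card_eq_fintype_card, Fintype.card_units, hm] at hζ
  have hpos : 0 < d * m := by
    have := Fintype.one_lt_card (α := K)
    refine Nat.pos_of_ne_zero fun h0 ↦ ?_
    rw [mul_assoc, h0] at hm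
    omega
  refine ⟨(ζ : K) ^ m, ?_⟩
  have hsq : (((ζ : K) ^ m) ^ d) ^ 2 = 1 := by
    have := pow_orderOf_eq_one ζ
    rw [hζ] at this
    rw [← pow_mul, ← pow_mul, show m * (d * 2) = 2 * d * m by ring, ← Units.val_pow_eq_pow_val, this,
      Units.val_one]
  refine (eq_or_eq_neg_of_sq_eq_sq _ 1 (by rw [hsq, one_pow])).resolve_left ?_
  intro h1
  have hdvd : orderOf ζ ∣ m * d := by
    refine orderOf_dvd_of_pow_eq_one (Units.ext ?_)
    rw [Units.val_pow_eq_pow_val, pow_mul, h1, Units.val_one]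
  have := Nat.le_of_dvd (by linarith [mul_comm m d]) hdvd
  rw [hζ] at this
  nlinarith

theorem exists_pow_sub_one_eq_neg_one_iff {p n k : ℕ} (hp : 1 < p) (hodd : Odd p) (hn : n ≠ 0)
    (hk : k ≠ 0) {K : Type*} [Field K] [Fintype K] (hcard : Fintype.card K = p ^ n) :
    (∃ β : K, β ^ (p ^ k - 1) = -1) ↔ Even (n / n.gcd k) := by
  obtain ⟨a, ha⟩ := n.gcd_dvd_left k
  obtain ⟨b, hb⟩ := n.gcd_dvd_right k
  have he : 0 < n.gcd k := Nat.gcd_pos_of_pos_left _ (Nat.pos_of_ne_zero hn)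
  have hcop : a.Coprime b := by
    have := Nat.coprime_div_gcd_div_gcd he
    rwa [Nat.div_eq_of_eq_mul_right he ha, Nat.div_eq_of_eq_mul_right he hb] at this
  rw [Nat.div_eq_of_eq_mul_right he ha]
  generalize n.gcd k = e at *
  subst ha hb
  constructor
  · rintro ⟨β, hβ⟩
    obtain ⟨h0, h⟩ := (pow_sub_one_eq_neg_one_iff (Nat.one_lt_pow hk hp)).mp hβ
    have h1 := pow_pow_mul_eq_neg_one_pow_mul hodd h a
    rw [show e * b * a = (e * a) * b by ring, pow_mul p, ← hcard, FiniteField.pow_card_pow] at h1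
    by_contra hcon
    rw [Nat.not_even_iff_odd] at hcon
    rw [hcon.neg_one_pow] at h1
    have hchar : ringChar K ≠ 2 := by
      rw [Ne, FiniteField.even_card_iff_char_two, hcard, ← Nat.even_iff, Nat.not_even_iff_odd]
      exact hodd.pow
    exact Ring.neg_one_ne_one_of_char_ne_two hchar
      (mul_right_cancel₀ h0 (by rw [← h1, one_mul]))
  · intro hev
    have hbodd : Odd b := by
      rw [← Nat.not_even_iff_odd]
      intro hb
      have := Nat.dvd_gcd hev.two_dvd hb.two_dvd
      rw [hcop] at this
      omega
    have hdvd : 2 * (p ^ e - 1) ∣ Fintype.card K - 1 := by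
      obtain ⟨c, rfl⟩ := hev.two_dvd
      have h2 : 2 ∣ p ^ e + 1 := (hodd.pow.add_odd odd_one).two_dvd
      refine (Nat.mul_dvd_mul_right h2 _).trans ?_
      rw [hcard, show (p ^ e + 1) * (p ^ e - 1) = p ^ (e * 2) - 1 by
        simpa [pow_mul] using (Nat.sq_sub_sq (p ^ e) 1).symm, ← mul_assoc, pow_mul p (e * 2)]
      simpa using Nat.sub_dvd_pow_sub_pow (p ^ (e * 2)) 1 c
    obtain ⟨β, hβ⟩ := exists_pow_eq_neg_one_of_two_mul_dvd hdvd
    obtain ⟨h0, h⟩ := (pow_sub_one_eq_neg_one_iff (Nat.one_lt_pow he.ne' hp)).mp hβ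
    refine ⟨β, (pow_sub_one_eq_neg_one_iff (Nat.one_lt_pow hk hp)).mpr ⟨h0, ?_⟩⟩
    rw [pow_pow_mul_eq_neg_one_pow_mul hodd h, hbodd.neg_one_pow, neg_one_mul]

theorem card_pow_sub_one_eq_neg_one {p n k : ℕ} (hp : 1 < p) (hodd : Odd p) (hn : n ≠ 0)
    (hk : k ≠ 0) {K : Type*} [Field K] [Fintype K] (hcard : Fintype.card K = p ^ n)
    (hev : Even (n / n.gcd k)) :
    Nat.card {β : K // β ^ (p ^ k - 1) = -1} = p ^ n.gcd k - 1 := by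
  have hpk : 1 < p ^ k := Nat.one_lt_pow hk hp
  rw [card_pow_eq_neg_one_of_exists (by omega)
    ((exists_pow_sub_one_eq_neg_one_iff hp hodd hn hk hcard).mpr hev), hcard,
    Nat.pow_sub_one_gcd_pow_sub_one]

theorem count_beta_pow_eq_neg_one (p n k : ℕ) [Fact p.Prime] (hp : Odd p) (hn : 2 ≤ n)
    (hk1 : 1 ≤ k) (hkn : k < n) (e : ℕ) (he : e = Nat.gcd n k)
    (K : Type*) [Field K] [Fintype K] (hcard : Fintype.card K = p ^ n) :
    ((∃ β : K, β ^ (p ^ k - 1) = -1) ↔ Even (n / e)) ∧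
      (Even (n / e) → Nat.card {β : K // β ^ (p ^ k - 1) = -1} = p ^ e - 1) ∧
      (Even (n / e) → Nat.card {β : K // β ≠ 0 ∧ β ^ (p ^ (n - k)) + β = 0} = p ^ e - 1) := by
  subst he
  have hp1 : 1 < p := (Fact.out : p.Prime).one_lt
  have hgcd : n.gcd (n - k) = n.gcd k := Nat.gcd_self_sub_right hkn.le
  refine ⟨exists_pow_sub_one_eq_neg_one_iff hp1 hp (by omega) (by omega) hcard,
    card_pow_sub_one_eq_neg_one hp1 hp (by omega) (by omega) hcard, fun hev ↦ ?_⟩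
  rw [← hgcd] at hev ⊢
  rw [← card_pow_sub_one_eq_neg_one hp1 hp (by omega) (by omega) hcard hev]
  simp only [pow_sub_one_eq_neg_one_iff (Nat.one_lt_pow (by omega : n - k ≠ 0) hp1),
    add_eq_zero_iff_eq_neg]
end

section
/- Let p be an odd prime, n ≥ 2, q = p^n, 1 ≤ k < n, and D = gcd(2k,n). For α, β ∈ 𝔽_q with α + β ≠ 0, the map L_{α,β} : 𝔽_q → 𝔽_q, L_{α,β}(x) = (α+β)·x^{p^{2k}} + (β^{p^{n−k}}+β)·x, is a bijection of 𝔽_q if and only if (−1)^{n/D}·((β^{p^{n−k}}+β)/(α+β))^{(q−1)/(p^D−1)} ≠ 1. -/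
open scoped BigOperators Classical

/-- In a finite cyclic group, `y` is a `d`-th power iff `y` is killed by `|G| / gcd(|G|, d)`. -/
theorem IsCyclic.exists_pow_eq_iff_pow_card_div_gcd_eq_one {G : Type*} [CommGroup G] [IsCyclic G]
    [Finite G] (d : ℕ) (y : G) :
    (∃ x : G, x ^ d = y) ↔ y ^ (Nat.card G / (Nat.card G).gcd d) = 1 := by
  have hdvd : (Nat.card G).gcd d ∣ Nat.card G := Nat.gcd_dvd_left _ _
  have hle : (powMonoidHom d : G →* G).range ≤
      (powMonoidHom (Nat.card G / (Nat.card G).gcd d) : G →* G).ker := by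
    rintro _ ⟨x, rfl⟩
    rw [MonoidHom.mem_ker, powMonoidHom_apply, powMonoidHom_apply, ← pow_mul,
      ← Nat.mul_div_assoc _ hdvd, mul_comm d, Nat.mul_div_assoc _ (Nat.gcd_dvd_right _ _),
      pow_mul, pow_card_eq_one', one_pow]
  have heq := Subgroup.eq_of_le_of_card_ge hle (by
    rw [IsCyclic.card_powMonoidHom_range, IsCyclic.card_powMonoidHom_ker,
      Nat.gcd_eq_right (Nat.div_dvd_of_dvd hdvd)])
  exact SetLike.ext_iff.mp heq y

/-- The quotient `(p ^ n - 1) / (p ^ D - 1)` is a sum of `n / D` powers of `p`, so for odd `p` it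
has the parity of `n / D`. -/
theorem Odd.even_pow_sub_one_div_iff {p n D : ℕ} (hp : Odd p) (hp1 : 1 < p) (hD : D ≠ 0)
    (hDn : D ∣ n) : Even ((p ^ n - 1) / (p ^ D - 1)) ↔ Even (n / D) := by
  obtain ⟨m, rfl⟩ := hDn
  have h2 : 2 ≤ p ^ D := Nat.one_lt_pow hD hp1
  rw [Nat.mul_div_cancel_left _ (Nat.pos_of_ne_zero hD), pow_mul, ← Nat.geomSum_eq h2,
    ← Nat.not_odd_iff_even, ← Nat.not_odd_iff_even, Finset.odd_sum_iff_odd_card_odd,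
    Finset.filter_true_of_mem fun i _ => (hp.pow).pow, Finset.card_range]

/-- A binomial additive polynomial `a X ^ (p ^ m) + b X` over a finite field of characteristic `p`
permutes the field iff it has no nonzero root. -/
theorem FiniteField.bijective_binomial_iff (p m : ℕ) [Fact p.Prime] {K : Type*} [Field K]
    [Finite K] [CharP K p] {a : K} (ha : a ≠ 0) (b : K) :
    Function.Bijective (fun x : K => a * x ^ (p ^ m) + b * x) ↔
      ¬ ∃ x : Kˣ, (x : K) ^ (p ^ m - 1) = -(b / a) := by
  have hpos : 0 < p ^ m := pow_pos (Nat.Prime.pos Fact.out) m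
  have root_iff : ∀ x : K, x ≠ 0 →
      (a * x ^ (p ^ m) + b * x = 0 ↔ x ^ (p ^ m - 1) = -(b / a)) := fun x hx => by
    rw [← Nat.sub_add_cancel hpos, pow_succ, Nat.add_sub_cancel,
      show a * (x ^ (p ^ m - 1) * x) + b * x = (a * x) * (x ^ (p ^ m - 1) - -(b / a)) by
        field_simp; ring]
    simp [ha, hx, eq_neg_iff_add_eq_zero]
  rw [← Finite.injective_iff_bijective]
  constructor
  · rintro hinj ⟨x, hx⟩
    refine x.ne_zero (hinj ?_)
    simp only [(root_iff x x.ne_zero).mpr hx, zero_pow hpos.ne', mul_zero, add_zero]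
  · intro h x y hxy
    by_contra hne
    have hsub := sub_ne_zero.mpr hne
    refine h ⟨Units.mk0 _ hsub, (root_iff _ hsub).mp ?_⟩
    rw [sub_pow_char_pow]
    linear_combination hxy

theorem linearized_bijective_iff_norm_ne_one (p n k : ℕ) [Fact p.Prime] (hp : Odd p)
    (hn : 2 ≤ n) (hk1 : 1 ≤ k) (hkn : k < n) (D : ℕ) (hD : D = Nat.gcd (2 * k) n)
    (K : Type*) [Field K] [Fintype K] (hcard : Fintype.card K = p ^ n)
    (α β : K) (hab : α + β ≠ 0) :
    Function.Bijective
        (fun x : K => (α + β) * x ^ (p ^ (2 * k)) + (β ^ (p ^ (n - k)) + β) * x) ↔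
      (-1 : K) ^ (n / D) *
          ((β ^ (p ^ (n - k)) + β) / (α + β)) ^ ((p ^ n - 1) / (p ^ D - 1)) ≠ 1 := by
  have hprime : p.Prime := Fact.out
  have : CharP K p := charP_of_card_eq_prime_pow hcard
  have hDn : D ∣ n := hD ▸ Nat.gcd_dvd_right _ _
  have hD0 : D ≠ 0 := fun h => by
    rw [h, zero_dvd_iff] at hDn
    omega
  have hsign : (-1 : K) ^ (n / D) = (-1) ^ ((p ^ n - 1) / (p ^ D - 1)) :=
    neg_one_pow_congr (hp.even_pow_sub_one_div_iff hprime.one_lt hD0 hDn).symm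
  have hcard' : Nat.card Kˣ = p ^ n - 1 := by
    rw [Nat.card_units, Nat.card_eq_fintype_card, hcard]
  have hgcd : (Nat.card Kˣ).gcd (p ^ (2 * k) - 1) = p ^ D - 1 := by
    rw [hcard', Nat.pow_sub_one_gcd_pow_sub_one, Nat.gcd_comm, ← hD]
  rw [FiniteField.bijective_binomial_iff p (2 * k) hab, hsign, ← mul_pow, neg_one_mul]
  refine not_congr ?_
  generalize -((β ^ (p ^ (n - k)) + β) / (α + β)) = c
  rcases eq_or_ne c 0 with rfl | hc
  · have hexp : (p ^ n - 1) / (p ^ D - 1) ≠ 0 := by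
      have hpD : 1 < p ^ D := Nat.one_lt_pow hD0 hprime.one_lt
      have hle : p ^ D ≤ p ^ n := Nat.pow_le_pow_right hprime.pos (Nat.le_of_dvd (by omega) hDn)
      exact (Nat.div_pos (by omega) (by omega)).ne'
    simp [hexp]
  · have key := IsCyclic.exists_pow_eq_iff_pow_card_div_gcd_eq_one (p ^ (2 * k) - 1)
      (Units.mk0 c hc)
    rw [hgcd, hcard'] at key
    simpa [Units.ext_iff] using key
end

section
/- Let p be an odd prime, n ≥ 2, q = p^n, 1 ≤ k < n, e = gcd(n,k) with n/e even, and write n = 2m. Let α, β ∈ 𝔽_q \ {0} with α ≠ −β and β^{p^{n−k}} = −β. Then S_{α,β}·S_{−α,−β} = p^{n+2e} if (α+β)^{(q−1)/(p^e+1)} = (−1)^{m/e}, and S_{α,β}·S_{−α,−β} = p^n otherwise. -/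
open scoped BigOperators Classical

/-- In a finite cyclic group `G` the equation `x ^ N = c` is solvable exactly when
`c ^ (|G| / gcd(|G|, N)) = 1`. -/
theorem IsCyclic.mem_range_powMonoidHom_iff {G : Type*} [CommGroup G] [IsCyclic G] [Finite G]
    (N : ℕ) (c : G) :
    c ∈ (powMonoidHom N : G →* G).range ↔ c ^ (Nat.card G / (Nat.card G).gcd N) = 1 := by
  have hdvd := Nat.gcd_dvd_left (Nat.card G) N
  have hle : (powMonoidHom N : G →* G).range ≤
      (powMonoidHom (Nat.card G / (Nat.card G).gcd N) : G →* G).ker := by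
    rintro _ ⟨x, rfl⟩
    rw [MonoidHom.mem_ker, powMonoidHom_apply, powMonoidHom_apply, ← pow_mul,
      ← Nat.mul_div_assoc _ hdvd, mul_comm, Nat.mul_div_assoc _ (Nat.gcd_dvd_right _ _), pow_mul,
      pow_card_eq_one', one_pow]
  have heq := Subgroup.eq_of_le_of_card_ge hle (by
    rw [IsCyclic.card_powMonoidHom_ker, IsCyclic.card_powMonoidHom_range,
      Nat.gcd_eq_right (Nat.div_dvd_of_dvd hdvd)])
  rw [heq, MonoidHom.mem_ker, powMonoidHom_apply]

theorem IsCyclic.card_pow_eq {G : Type*} [CommGroup G] [IsCyclic G] [Finite G] (N : ℕ) (c : G) :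
    Nat.card {x : G // x ^ N = c} =
      if c ^ (Nat.card G / (Nat.card G).gcd N) = 1 then (Nat.card G).gcd N else 0 := by
  split_ifs with h
  · obtain ⟨y, hy⟩ := (IsCyclic.mem_range_powMonoidHom_iff N c).2 h
    rw [powMonoidHom_apply] at hy
    rw [← IsCyclic.card_powMonoidHom_ker]
    refine Nat.card_congr ((Equiv.mulRight y⁻¹).subtypeEquiv fun x ↦ ?_)
    simp [MonoidHom.mem_ker, mul_pow, hy, mul_inv_eq_one]
  · rw [Nat.card_eq_zero]
    exact .inl ⟨fun x ↦ h ((IsCyclic.mem_range_powMonoidHom_iff N c).1 ⟨x.1, x.2⟩)⟩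

theorem exists_pow_two_mul_eq (b r : ℕ) (hb : Even b) :
    ∃ M, (b + 1) ^ (2 * r) = M * ((b + 1) ^ 2 - 1) + 1 ∧ (Even M ↔ Even r) := by
  have hsub : (b + 1) ^ 2 - 1 = b * (b + 2) := by
    rw [Nat.sub_eq_iff_eq_add (Nat.one_le_pow 2 (b + 1) b.succ_pos)]
    ring
  rw [hsub]
  induction r with
  | zero => exact ⟨0, by simp⟩
  | succ r ih =>
    obtain ⟨M, hM, hpar⟩ := ih
    refine ⟨(b + 1) ^ 2 * M + 1, ?_, ?_⟩
    · rw [mul_add, pow_add, hM]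
      ring
    · have : ¬ Even (b + 1) := by simpa [Nat.even_add_one] using hb
      simp [Nat.even_add_one, Nat.even_mul, Nat.even_pow, this, hpar]

theorem exists_pow_two_mul_add_one_eq (b j : ℕ) :
    ∃ s, (b + 1) ^ (2 * j + 1) = (1 + (b + 2) * s) * b + 1 := by
  induction j with
  | zero => exact ⟨0, by ring⟩
  | succ j ih =>
    obtain ⟨s, hs⟩ := ih
    refine ⟨(b + 1) ^ 2 * s + (b + 1), ?_⟩
    rw [mul_add, add_right_comm, pow_add, hs]
    ring

section FiniteField

variable (p : ℕ) [Fact p.Prime] (K : Type*) [Field K] [Fintype K] [Algebra (ZMod p) K]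

/-- `chi1` as a bundled additive character. -/
noncomputable def chi1AddChar : AddChar K ℂ :=
  ZMod.stdAddChar.compAddMonoidHom (Algebra.trace (ZMod p) K).toAddMonoidHom

omit [Fintype K] in
theorem chi1_eq_chi1AddChar (a : K) : chi1 p K a = chi1AddChar p K a := by
  have h : chi1AddChar p K a = ZMod.stdAddChar (Algebra.trace (ZMod p) K a) := rfl
  rw [h, ZMod.stdAddChar_apply, ZMod.toCircle_apply, chi1]

theorem isPrimitive_chi1AddChar : (chi1AddChar p K).IsPrimitive := by
  refine AddChar.IsPrimitive.of_ne_one fun h ↦ ?_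
  refine one_ne_zero ((traceForm_nondegenerate (ZMod p) K).1 (1 : K) fun b ↦ ?_)
  rw [Algebra.traceForm_apply, one_mul]
  refine ZMod.injective_stdAddChar ?_
  rw [AddChar.map_zero_eq_one]
  exact DFunLike.congr_fun h b

variable {K}

theorem chi1AddChar_pow_pow (a : K) (i : ℕ) :
    chi1AddChar p K (a ^ p ^ i) = chi1AddChar p K a := by
  induction i with
  | zero => simp
  | succ i ih =>
    rw [pow_succ, pow_mul, ← ih]
    refine congrArg ZMod.stdAddChar ?_
    have := Algebra.trace_eq_of_algEquiv
      (FiniteField.frobeniusAlgEquivOfAlgebraic (ZMod p) K) (a ^ p ^ i)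
    simpa [FiniteField.coe_frobeniusAlgEquivOfAlgebraic, ZMod.card] using this

variable {p} {n k : ℕ} (hkn : k ≤ n) (hcard : Fintype.card K = p ^ n)
include hkn hcard

omit [Fact p.Prime] [Algebra (ZMod p) K] in
theorem pow_pow_pow_sub (x : K) : (x ^ p ^ k) ^ p ^ (n - k) = x := by
  rw [← pow_mul, ← pow_add, Nat.add_sub_cancel' hkn, ← hcard, FiniteField.pow_card]

theorem chi1AddChar_mul_pow (a x : K) :
    chi1AddChar p K (a * x ^ p ^ k) = chi1AddChar p K (a ^ p ^ (n - k) * x) := by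
  rw [← chi1AddChar_pow_pow p _ (n - k), mul_pow, pow_pow_pow_sub hkn hcard]

theorem weilS_eq_of_pow_eq_neg (α β : K) (hβ : β ^ p ^ (n - k) = -β) :
    weilS p K (p ^ k + 1) α β =
      chi1AddChar p K β * ∑ x, chi1AddChar p K ((α + β) * x ^ (p ^ k + 1)) := by
  have := charP_of_injective_algebraMap (algebraMap (ZMod p) K).injective p
  rw [weilS, Finset.mul_sum]
  refine Finset.sum_congr rfl fun x _ ↦ ?_
  have h : α * x ^ (p ^ k + 1) + β * (x + 1) ^ (p ^ k + 1) =
      β + (α + β) * x ^ (p ^ k + 1) + (β * x ^ p ^ k + β * x) := by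
    rw [pow_succ (x + 1), add_pow_char_pow]
    ring
  rw [chi1_eq_chi1AddChar, h, AddChar.map_add_eq_mul, AddChar.map_add_eq_mul _ (β * x ^ p ^ k),
    chi1AddChar_mul_pow hkn hcard, hβ, ← AddChar.map_add_eq_mul, neg_mul, neg_add_cancel,
    AddChar.map_zero_eq_one, mul_one, AddChar.map_add_eq_mul]

/-- On the radical of the quadratic form `x ↦ Tr (γ x ^ (p ^ k + 1))` the form vanishes. -/
theorem chi1AddChar_eq_one_of_mem_radical (hp : Odd p) (γ z : K)
    (hz : (γ * z) ^ p ^ (n - k) + γ * z ^ p ^ k = 0) :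
    chi1AddChar p K (γ * z ^ (p ^ k + 1)) = 1 := by
  have h2 : chi1AddChar p K (γ * z ^ (p ^ k + 1)) ^ 2 = 1 := by
    calc _ = chi1AddChar p K (γ * z * z ^ p ^ k) * chi1AddChar p K (γ * z ^ p ^ k * z) := by
          rw [sq]; congr 2 <;> ring
      _ = 1 := by
          rw [chi1AddChar_mul_pow hkn hcard, ← AddChar.map_add_eq_mul, ← add_mul, hz, zero_mul,
            AddChar.map_zero_eq_one]
  have := charP_of_injective_algebraMap (algebraMap (ZMod p) K).injective p
  have hpow : chi1AddChar p K (γ * z ^ (p ^ k + 1)) ^ p = 1 := by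
    rw [← AddChar.map_nsmul_eq_pow, nsmul_eq_mul, CharP.cast_eq_zero, zero_mul,
      AddChar.map_zero_eq_one]
  have := pow_gcd_eq_one.2 ⟨h2, hpow⟩
  rwa [Nat.Coprime.gcd_eq_one (Nat.coprime_two_left.2 hp), pow_one] at this

open Finset in
theorem sum_chi1AddChar_mul_sum_neg (hp : Odd p) (γ : K) :
    (∑ x, chi1AddChar p K (γ * x ^ (p ^ k + 1))) * ∑ x, chi1AddChar p K (-γ * x ^ (p ^ k + 1)) =
      p ^ n * #{z : K | γ * z + γ ^ p ^ k * z ^ (p ^ k * p ^ k) = 0} := by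
  have := charP_of_injective_algebraMap (algebraMap (ZMod p) K).injective p
  have hrad (z : K) : (γ * z) ^ p ^ (n - k) + γ * z ^ p ^ k = 0 ↔
      γ * z + γ ^ p ^ k * z ^ (p ^ k * p ^ k) = 0 := by
    have h := pow_eq_zero_iff (M₀ := K) (a := (γ * z) ^ p ^ (n - k) + γ * z ^ p ^ k)
      (pow_ne_zero k (Fact.out : p.Prime).ne_zero)
    rw [← h, add_pow_char_pow, ← pow_mul, mul_comm (p ^ (n - k)), pow_mul,
      pow_pow_pow_sub hkn hcard, mul_pow, ← pow_mul]
  calc _ = ∑ y, ∑ x, chi1AddChar p K (γ * x ^ (p ^ k + 1)) *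
          chi1AddChar p K (-γ * y ^ (p ^ k + 1)) := by
        rw [sum_mul_sum, sum_comm]
    _ = ∑ y, ∑ z, chi1AddChar p K (γ * (z + y) ^ (p ^ k + 1)) *
          chi1AddChar p K (-γ * y ^ (p ^ k + 1)) :=
        sum_congr rfl fun y _ ↦ (Equiv.sum_comp (Equiv.addRight y) fun x ↦
          chi1AddChar p K (γ * x ^ (p ^ k + 1)) * chi1AddChar p K (-γ * y ^ (p ^ k + 1))).symm
    _ = ∑ z, ∑ y, chi1AddChar p K (γ * z ^ (p ^ k + 1)) *
          chi1AddChar p K (y * ((γ * z) ^ p ^ (n - k) + γ * z ^ p ^ k)) := by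
        rw [sum_comm]
        refine sum_congr rfl fun z _ ↦ sum_congr rfl fun y _ ↦ ?_
        have h : γ * (z + y) ^ (p ^ k + 1) + -γ * y ^ (p ^ k + 1) =
            γ * z ^ (p ^ k + 1) + (γ * z * y ^ p ^ k + γ * z ^ p ^ k * y) := by
          rw [pow_succ (z + y), add_pow_char_pow]
          ring
        rw [← AddChar.map_add_eq_mul, h, AddChar.map_add_eq_mul, AddChar.map_add_eq_mul _ (_ * _),
          chi1AddChar_mul_pow hkn hcard, ← AddChar.map_add_eq_mul, ← add_mul, mul_comm y]
    _ = ∑ z, if γ * z + γ ^ p ^ k * z ^ (p ^ k * p ^ k) = 0 then (p ^ n : ℂ) else 0 := by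
        refine sum_congr rfl fun z _ ↦ ?_
        rw [← mul_sum, AddChar.sum_mulShift _ (isPrimitive_chi1AddChar p K), hcard]
        simp only [hrad]
        split_ifs with h
        · rw [chi1AddChar_eq_one_of_mem_radical hkn hcard hp γ z ((hrad z).2 h)]
          simp
        · simp
    _ = _ := by
        rw [← sum_filter, sum_const, nsmul_eq_mul, mul_comm]

end FiniteField

open Finset in
/-- The nonzero elements of the radical are the units `u` with
`u ^ (P ^ 2 - 1) = -γ ^ (1 - P)`. -/
theorem card_radical_eq {K : Type*} [Field K] [Fintype K] (P : ℕ) (hP : 1 < P) (γ : Kˣ) :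
    #{z : K | (γ : K) * z + (γ : K) ^ P * z ^ (P * P) = 0} =
      1 + Nat.card {u : Kˣ // u ^ (P * P - 1) = -1 * (γ ^ (P - 1))⁻¹} := by
  have hPP : 1 < P * P := Nat.one_lt_mul_iff.2 ⟨by omega, by omega, .inl hP⟩
  have hset : ({z : K | (γ : K) * z + (γ : K) ^ P * z ^ (P * P) = 0} : Finset K) =
      insert 0 (({u : Kˣ | u ^ (P * P - 1) = -1 * (γ ^ (P - 1))⁻¹} : Finset Kˣ).map
        ⟨Units.val, Units.val_injective⟩) := by
    have key (u : Kˣ) : (γ : K) * u + (γ : K) ^ P * (u : K) ^ (P * P) = 0 ↔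
        u ^ (P * P - 1) = -1 * (γ ^ (P - 1))⁻¹ := by
      have h : (γ : K) * u + (γ : K) ^ P * (u : K) ^ (P * P) =
          (γ * u : K) * (u ^ (P * P - 1) * γ ^ (P - 1) + 1) := by
        obtain ⟨a, ha⟩ := Nat.exists_eq_add_of_lt hP
        obtain ⟨b, hb⟩ := Nat.exists_eq_add_of_lt hPP
        rw [hb, show P = 1 + a + 1 from ha, Nat.add_sub_cancel, Nat.add_sub_cancel]
        ring
      rw [h, mul_eq_zero_iff_left (mul_ne_zero γ.ne_zero u.ne_zero), add_eq_zero_iff_eq_neg,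
        eq_mul_inv_iff_mul_eq, Units.ext_iff]
      simp
    ext z
    simp only [mem_filter, mem_univ, true_and, mem_insert, mem_map, Function.Embedding.coeFn_mk]
    constructor
    · intro hz
      refine or_iff_not_imp_left.2 fun h0 ↦ ⟨Units.mk0 z h0, (key _).1 ?_, rfl⟩
      simpa using hz
    · rintro (rfl | ⟨u, hu, rfl⟩)
      · simp [show P ≠ 0 by omega]
      · exact (key u).2 hu
  rw [hset, card_insert_of_notMem (by simp), card_map, add_comm, Nat.card_eq_fintype_card,
    Fintype.card_subtype]

open Finset in
theorem card_radical {p n k e m : ℕ} [Fact p.Prime] (hp : Odd p) (hk1 : 1 ≤ k)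
    (he : e = Nat.gcd n k) (heven : Even (n / e)) (hm : n = 2 * m)
    {K : Type*} [Field K] [Fintype K] (hcard : Fintype.card K = p ^ n) (γ : Kˣ) :
    #{z : K | (γ : K) * z + (γ : K) ^ p ^ k * z ^ (p ^ k * p ^ k) = 0} =
      if γ ^ ((p ^ n - 1) / (p ^ e + 1)) = (-1) ^ (m / e) then p ^ (2 * e) else 1 := by
  have hp1 : 1 < p := (Fact.out : p.Prime).one_lt
  have he0 : 0 < e := he ▸ Nat.gcd_pos_of_pos_right _ hk1
  obtain ⟨n', hn'⟩ : e ∣ n := he ▸ Nat.gcd_dvd_left n k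
  obtain ⟨k', hk'⟩ : e ∣ k := he ▸ Nat.gcd_dvd_right n k
  have hcop : Nat.Coprime n' k' := by
    refine Nat.eq_of_mul_eq_mul_left he0 ?_
    rw [← Nat.gcd_mul_left, ← hn', ← hk', ← he, mul_one]
  rw [hn', Nat.mul_div_cancel_left _ he0] at heven
  obtain ⟨r, hr⟩ := heven.two_dvd
  have hk'odd : Odd k' := by
    rw [← Nat.coprime_two_left]
    exact hcop.coprime_dvd_left heven.two_dvd
  obtain ⟨j, hj⟩ := hk'odd
  have hmr : m / e = r := by
    have : m = e * r := by
      have : 2 * m = 2 * (e * r) := by rw [← hm, hn', hr]; ring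
      omega
    rw [this, Nat.mul_div_cancel_left _ he0]
  have hgcd : Nat.gcd n (2 * k) = 2 * e := by
    have : Nat.gcd r k' = 1 := hcop.coprime_dvd_left ⟨2, by rw [hr, mul_comm]⟩
    rw [show n = 2 * e * r by rw [hn', hr]; ring, show 2 * k = 2 * e * k' by rw [hk']; ring,
      Nat.gcd_mul_left, this, mul_one]
  have hunits : Nat.card Kˣ = p ^ n - 1 := by
    rw [Nat.card_units, Nat.card_eq_fintype_card, hcard]
  have hG : (Nat.card Kˣ).gcd (p ^ k * p ^ k - 1) = p ^ (2 * e) - 1 := by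
    rw [hunits, ← sq, ← pow_mul, mul_comm k, Nat.pow_sub_one_gcd_pow_sub_one, hgcd]
  obtain ⟨b, hb⟩ : ∃ b, p ^ e = b + 1 := Nat.exists_eq_add_of_le' (Nat.one_le_pow _ _ (by omega))
  have hbeven : Even b := by
    have : Odd (b + 1) := hb ▸ hp.pow
    grind
  obtain ⟨M, hM, hpar⟩ := exists_pow_two_mul_eq b r hbeven
  obtain ⟨s, hs⟩ := exists_pow_two_mul_add_one_eq b j
  have hpn : p ^ n = (b + 1) ^ (2 * r) := by rw [hn', hr, pow_mul, hb]
  have hpk : p ^ k = (b + 1) ^ (2 * j + 1) := by rw [hk', hj, pow_mul, hb]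
  have hp2e : p ^ (2 * e) = (b + 1) ^ 2 := by rw [mul_comm, pow_mul, hb]
  have hb0 : 0 < b := by
    have := Nat.one_lt_pow he0.ne' hp1
    omega
  have hsub : (b + 1) ^ 2 - 1 = b * (b + 2) := by
    rw [Nat.sub_eq_iff_eq_add (Nat.one_le_pow 2 (b + 1) b.succ_pos)]
    ring
  have hqM : p ^ n - 1 = M * (b * (b + 2)) := by rw [hpn, hM, hsub, Nat.add_sub_cancel]
  have hMdiv : (p ^ n - 1) / (p ^ (2 * e) - 1) = M := by
    rw [hqM, hp2e, hsub, Nat.mul_div_cancel _ (by positivity)]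
  have hA : (p ^ n - 1) / (p ^ e + 1) = M * b := by
    rw [hqM, hb, ← mul_assoc, Nat.mul_div_cancel _ (by positivity)]
  have hexp : (p ^ k - 1) * M = M * b + (p ^ n - 1) * s := by
    rw [hpk, hs, hqM, Nat.add_sub_cancel]
    ring
  have hcond : (-1 * (γ ^ (p ^ k - 1))⁻¹ : Kˣ) ^ M = 1 ↔ γ ^ (M * b) = (-1) ^ r := by
    have hsign : (-1 : Kˣ) ^ M = (-1) ^ r := by
      rcases Nat.even_or_odd r with h | h
      · rw [h.neg_one_pow, (hpar.2 h).neg_one_pow]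
      · rw [h.neg_one_pow, (Nat.not_even_iff_odd.1
          (hpar.not.2 (Nat.not_even_iff_odd.2 h))).neg_one_pow]
    rw [mul_pow, inv_pow, ← pow_mul, hexp, pow_add, pow_mul γ (p ^ n - 1), ← hunits,
      pow_card_eq_one', one_pow, mul_one, hsign, mul_inv_eq_one, eq_comm]
  rw [card_radical_eq _ (Nat.one_lt_pow (Nat.one_le_iff_ne_zero.1 hk1) hp1), IsCyclic.card_pow_eq, hG, hunits, hMdiv,
    hA, hmr]
  simp only [hcond]
  split_ifs
  · have : 0 < p ^ (2 * e) := by positivity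
    omega
  · rfl

theorem weilS_product_semi_degenerate (p n k e m : ℕ) [Fact p.Prime] (hp : Odd p) (hn : 2 ≤ n)
    (hk1 : 1 ≤ k) (hkn : k < n) (he : e = Nat.gcd n k) (heven : Even (n / e))
    (hm : n = 2 * m)
    (K : Type*) [Field K] [Fintype K] [Algebra (ZMod p) K]
    (hcard : Fintype.card K = p ^ n)
    (α β : K) (hα0 : α ≠ 0) (hβ0 : β ≠ 0) (hαβ : α ≠ -β) (hβ : β ^ (p ^ (n - k)) = -β) :
    ((α + β) ^ ((p ^ n - 1) / (p ^ e + 1)) = (-1 : K) ^ (m / e) →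
        weilS p K (p ^ k + 1) α β * weilS p K (p ^ k + 1) (-α) (-β) = (p : ℂ) ^ (n + 2 * e)) ∧
      ((α + β) ^ ((p ^ n - 1) / (p ^ e + 1)) ≠ (-1 : K) ^ (m / e) →
        weilS p K (p ^ k + 1) α β * weilS p K (p ^ k + 1) (-α) (-β) = (p : ℂ) ^ n) := by
  have hγ : α + β ≠ 0 := fun h ↦ hαβ (eq_neg_of_add_eq_zero_left h)
  have hβ' : (-β) ^ p ^ (n - k) = -(-β) := by rw [hp.pow.neg_pow, hβ]
  have hprod : weilS p K (p ^ k + 1) α β * weilS p K (p ^ k + 1) (-α) (-β) =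
      (p : ℂ) ^ n * ((if Units.mk0 (α + β) hγ ^ ((p ^ n - 1) / (p ^ e + 1)) = (-1) ^ (m / e)
        then p ^ (2 * e) else 1 : ℕ) : ℂ) := by
    rw [weilS_eq_of_pow_eq_neg hkn.le hcard α β hβ,
      weilS_eq_of_pow_eq_neg hkn.le hcard (-α) (-β) hβ', mul_mul_mul_comm,
      ← AddChar.map_add_eq_mul, add_neg_cancel, AddChar.map_zero_eq_one, one_mul, ← neg_add,
      sum_chi1AddChar_mul_sum_neg hkn.le hcard hp,
      ← card_radical hp hk1 he heven hm hcard (Units.mk0 (α + β) hγ), Units.val_mk0]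
  have hiff : Units.mk0 (α + β) hγ ^ ((p ^ n - 1) / (p ^ e + 1)) = (-1) ^ (m / e) ↔
      (α + β) ^ ((p ^ n - 1) / (p ^ e + 1)) = (-1 : K) ^ (m / e) := by
    simp [Units.ext_iff]
  rw [hprod]
  simp only [hiff]
  refine ⟨fun h ↦ ?_, fun h ↦ ?_⟩
  · rw [if_pos h, Nat.cast_pow, ← pow_add]
  · rw [if_neg h, Nat.cast_one, mul_one]
end
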